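/- Fix an integer C ≥ 1 and real parameters n, N. On the open set U of pairs (s,t) ∈ ℝ² with N − s > 0 and 0 < (n−t)/(N−s) < C, let λ(s,t) be the unique positive solution of λ g′(λ)/g(λ) = (n−t)/(N−s), and define F(s,t) = (n−t)·log λ(s,t) − (N−s)·log g(λ(s,t)). Then F is differentiable on U with partial derivatives ∂F/∂t (s,t) = −log λ(s,t) and ∂F/∂s (s,t) = log g(λ(s,t)). -/

import Mathlib

open Finset
open scoped BigOperators

/-- `g(λ) = ∑_{k=0}^C λ^k / k!`. -/
noncomputable def gfun (C : ℕ) (x : ℝ) : ℝ :=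
  ∑ k ∈ Finset.range (C + 1), x ^ k / (Nat.factorial k)

theorem gfun_pos (C : ℕ) {x : ℝ} (hx : 0 < x) : 0 < gfun C x := by
  unfold gfun
  exact Finset.sum_pos (fun k _ => by positivity) ⟨0, by simp⟩

theorem continuous_gfun (C : ℕ) : Continuous (gfun C) := by
  unfold gfun
  fun_prop

theorem mul_deriv_gfun (C : ℕ) (x : ℝ) :
    x * deriv (gfun C) x =
      ∑ k ∈ Finset.range (C + 1), (k : ℝ) * (x ^ k / (Nat.factorial k)) := by
  have h : HasDerivAt (gfun C)
      (∑ k ∈ Finset.range (C + 1), ((k : ℝ) * x ^ (k - 1)) / (Nat.factorial k)) x := by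
    unfold gfun
    exact HasDerivAt.fun_sum fun k _ => (hasDerivAt_pow k x).div_const _
  rw [h.deriv, Finset.mul_sum]
  refine Finset.sum_congr rfl fun k _ => ?_
  rcases k with _ | k
  · simp
  · rw [Nat.add_sub_cancel, pow_succ]
    ring

theorem sub_mul_cross_pow_nonneg {x y : ℝ} (hx : 0 < x) (hxy : x < y) (j k : ℕ) :
    0 ≤ ((k : ℝ) - j) * (y ^ k * x ^ j - x ^ k * y ^ j) := by
  have key : ∀ i d : ℕ, x ^ (i + d) * y ^ i ≤ y ^ (i + d) * x ^ i := by
    intro i d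
    have hd : x ^ d ≤ y ^ d := pow_le_pow_left₀ hx.le hxy.le d
    have hp : 0 ≤ x ^ i * y ^ i := by have := hx.trans hxy; positivity
    rw [pow_add, pow_add]
    nlinarith [mul_le_mul_of_nonneg_left hd hp]
  rcases le_total j k with h | h
  · obtain ⟨d, rfl⟩ := Nat.exists_eq_add_of_le h
    refine mul_nonneg ?_ (sub_nonneg.2 (key j d))
    push_cast
    linarith [(Nat.cast_nonneg d : (0 : ℝ) ≤ d)]
  · obtain ⟨d, rfl⟩ := Nat.exists_eq_add_of_le h
    refine mul_nonneg_of_nonpos_of_nonpos ?_ ?_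
    · push_cast
      linarith [(Nat.cast_nonneg d : (0 : ℝ) ≤ d)]
    · linarith [key k d, mul_comm (x ^ (k + d)) (y ^ k), mul_comm (y ^ (k + d)) (x ^ k)]

/-- The logarithmic derivative `x g'(x) / g(x)` is strictly increasing on `(0, ∞)`. -/
theorem strictMonoOn_mul_deriv_gfun_div {C : ℕ} (hC : 1 ≤ C) :
    StrictMonoOn (fun x => x * deriv (gfun C) x / gfun C x) (Set.Ioi 0) := by
  intro x hx y hy hxy
  have hx : 0 < x := hx
  have hy : 0 < y := hy
  have hcross :
      2 * ((y * deriv (gfun C) y) * gfun C x - (x * deriv (gfun C) x) * gfun C y) =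
        ∑ k ∈ Finset.range (C + 1), ∑ j ∈ Finset.range (C + 1),
          (((k : ℝ) - j) * (y ^ k * x ^ j - x ^ k * y ^ j)) /
            ((Nat.factorial k) * (Nat.factorial j)) := by
    have hA : (y * deriv (gfun C) y) * gfun C x - (x * deriv (gfun C) x) * gfun C y =
        ∑ k ∈ Finset.range (C + 1), ∑ j ∈ Finset.range (C + 1),
          ((k : ℝ) * (y ^ k * x ^ j - x ^ k * y ^ j)) /
            ((Nat.factorial k) * (Nat.factorial j)) := by
      rw [mul_deriv_gfun, mul_deriv_gfun, gfun, gfun, Finset.sum_mul_sum, Finset.sum_mul_sum,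
        ← Finset.sum_sub_distrib]
      refine Finset.sum_congr rfl fun k _ => ?_
      rw [← Finset.sum_sub_distrib]
      refine Finset.sum_congr rfl fun j _ => ?_
      field_simp
    rw [two_mul]
    nth_rewrite 2 [hA]
    rw [Finset.sum_comm, hA, ← Finset.sum_add_distrib]
    refine Finset.sum_congr rfl fun k _ => ?_
    rw [← Finset.sum_add_distrib]
    refine Finset.sum_congr rfl fun j _ => ?_
    field_simp
    ring
  have hnonneg : ∀ k j : ℕ, 0 ≤ (((k : ℝ) - j) * (y ^ k * x ^ j - x ^ k * y ^ j)) /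
      ((Nat.factorial k) * (Nat.factorial j)) := fun k j =>
    div_nonneg (sub_mul_cross_pow_nonneg hx hxy j k) (by positivity)
  have hpos : 0 < ∑ k ∈ Finset.range (C + 1), ∑ j ∈ Finset.range (C + 1),
      (((k : ℝ) - j) * (y ^ k * x ^ j - x ^ k * y ^ j)) /
        ((Nat.factorial k) * (Nat.factorial j)) := by
    refine Finset.sum_pos' (fun k _ => Finset.sum_nonneg fun j _ => hnonneg k j)
      ⟨1, by simp; omega, ?_⟩
    exact Finset.sum_pos' (fun j _ => hnonneg 1 j) ⟨0, by simp, by simpa using hxy⟩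
  change _ / _ < _ / _
  rw [div_lt_div_iff₀ (gfun_pos C hx) (gfun_pos C hy)]
  linarith

/-- `u ↦ log g(exp u)` lies above its tangent lines. -/
theorem mul_log_sub_log_le_log_gfun_sub (C : ℕ) {x y : ℝ} (hx : 0 < x) (hy : 0 < y) :
    x * deriv (gfun C) x / gfun C x * (Real.log y - Real.log x) ≤
      Real.log (gfun C y) - Real.log (gfun C x) := by
  have hgx := gfun_pos C hx
  have hgy := gfun_pos C hy
  have hJ := convexOn_exp.map_sum_le (t := Finset.range (C + 1))
    (w := fun k => x ^ k / (Nat.factorial k) / gfun C x)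
    (p := fun k => (k : ℝ) * (Real.log y - Real.log x))
    (fun k _ => by positivity)
    (by rw [← Finset.sum_div]; exact div_self hgx.ne')
    (fun _ _ => Set.mem_univ _)
  have hl : ∑ k ∈ Finset.range (C + 1), (x ^ k / (Nat.factorial k) / gfun C x) •
      ((k : ℝ) * (Real.log y - Real.log x)) =
      x * deriv (gfun C) x / gfun C x * (Real.log y - Real.log x) := by
    rw [mul_deriv_gfun, Finset.sum_div, Finset.sum_mul]
    refine Finset.sum_congr rfl fun k _ => ?_
    rw [smul_eq_mul]
    ring
  have hr : ∑ k ∈ Finset.range (C + 1), (x ^ k / (Nat.factorial k) / gfun C x) •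
      Real.exp ((k : ℝ) * (Real.log y - Real.log x)) = gfun C y / gfun C x := by
    conv_rhs => rw [gfun, Finset.sum_div]
    refine Finset.sum_congr rfl fun k _ => ?_
    rw [← Real.log_div hy.ne' hx.ne', Real.exp_nat_mul, Real.exp_log (div_pos hy hx), div_pow,
      smul_eq_mul]
    field_simp
  rw [hl, hr] at hJ
  rw [← Real.log_div hgy.ne' hgx.ne']
  exact (Real.le_log_iff_exp_le (div_pos hgy hgx)).2 hJ

/-- A positive solution of `h (l q) = r q`, with `h` strictly monotone on `(0, ∞)`, depends continuously
on `q` wherever `r` does. -/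
theorem StrictMonoOn.continuousAt_of_comp_eventuallyEq {X : Type*} [TopologicalSpace X]
    {h : ℝ → ℝ} (hh : StrictMonoOn h (Set.Ioi 0)) {r l : X → ℝ} {p : X}
    (hr : ContinuousAt r p) (hl : ∀ᶠ q in nhds p, 0 < l q ∧ h (l q) = r q) :
    ContinuousAt l p := by
  obtain ⟨hp, hhp⟩ := hl.self_of_nhds
  refine tendsto_order.2 ⟨fun a ha => ?_, fun b hb => ?_⟩
  · rcases le_or_gt a 0 with h0 | h0
    · filter_upwards [hl] with q hq using h0.trans_lt hq.1
    · have : h a < r p := hhp ▸ hh h0 hp ha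
      filter_upwards [hl, hr.eventually_const_lt this] with q hq hq'
      exact (hh.lt_iff_lt h0 hq.1).1 (hq.2 ▸ hq')
  · have hb0 : 0 < b := hp.trans hb
    have : r p < h b := hhp ▸ hh hp hb0 hb
    filter_upwards [hl, hr.eventually_lt_const this] with q hq hq'
    exact (hh.lt_iff_lt hq.1 hb0).1 (hq.2 ▸ hq')

/-- Envelope theorem: a function with a continuous selection of subgradients is differentiable. -/
theorem hasFDerivAt_of_subgradient_continuousAt {E : Type*} [NormedAddCommGroup E]
    [NormedSpace ℝ E] {f : E → ℝ} {L : E → E →L[ℝ] ℝ} {p : E} (hL : ContinuousAt L p)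
    (hle : ∀ᶠ q in nhds p, L p (q - p) ≤ f q - f p ∧ f q - f p ≤ L q (q - p)) :
    HasFDerivAt f (L p) p := by
  refine HasFDerivAt.of_isLittleO (Asymptotics.isLittleO_iff.2 fun c hc => ?_)
  filter_upwards [hle, Metric.continuousAt_iff'.1 hL c hc] with q hq hq'
  rw [dist_eq_norm] at hq'
  have h1 : ‖(L q - L p) (q - p)‖ ≤ c * ‖q - p‖ :=
    (L q - L p).le_of_opNorm_le hq'.le _
  rw [sub_apply, Real.norm_eq_abs] at h1
  rw [Real.norm_eq_abs, abs_of_nonneg (by linarith)]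
  linarith [le_abs_self (L q (q - p) - L p (q - p))]

/-- **Lemma (first partial derivatives of `F`).** Fix `C ≥ 1` and reals `n, N`. On the
open set `U` of pairs `(s,t)` with `N − s > 0` and `0 < (n−t)/(N−s) < C`, let `λ(s,t)` be
the unique positive solution of `λ g'(λ)/g(λ) = (n−t)/(N−s)` and
`F(s,t) = (n−t) log λ(s,t) − (N−s) log g(λ(s,t))`. Then `F` is differentiable on `U`, with
`∂F/∂t = −log λ(s,t)` and `∂F/∂s = log g(λ(s,t))`. -/
theorem statement10 (C : ℕ) (hC : 1 ≤ C) (n N : ℝ)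
    (U : Set (ℝ × ℝ))
    (hU : U = {p : ℝ × ℝ | 0 < N - p.1 ∧ 0 < (n - p.2) / (N - p.1) ∧
        (n - p.2) / (N - p.1) < C})
    (lam : ℝ → ℝ → ℝ)
    (hlampos : ∀ s t, (s, t) ∈ U → 0 < lam s t)
    (hlam : ∀ s t, (s, t) ∈ U →
      lam s t * deriv (gfun C) (lam s t) / gfun C (lam s t) = (n - t) / (N - s))
    (F : ℝ → ℝ → ℝ)
    (hF : ∀ s t, F s t =
      (n - t) * Real.log (lam s t) - (N - s) * Real.log (gfun C (lam s t))) :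
    DifferentiableOn ℝ (fun p : ℝ × ℝ => F p.1 p.2) U ∧
    (∀ s t, (s, t) ∈ U →
      HasDerivAt (fun t' => F s t') (-Real.log (lam s t)) t ∧
      HasDerivAt (fun s' => F s' t) (Real.log (gfun C (lam s t))) s) := by
  have hUo : IsOpen U := by
    have : U = {p : ℝ × ℝ | 0 < N - p.1} ∩
        ({p : ℝ × ℝ | 0 < n - p.2} ∩ {p : ℝ × ℝ | n - p.2 < C * (N - p.1)}) := by
      rw [hU]
      ext p
      simp only [Set.mem_ofPred_eq, Set.mem_inter_iff]
      refine and_congr_right fun h => ?_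
      rw [div_lt_iff₀ h, div_pos_iff_of_pos_right h]
    rw [this]
    exact (isOpen_lt (by fun_prop) (by fun_prop)).inter
      ((isOpen_lt (by fun_prop) (by fun_prop)).inter (isOpen_lt (by fun_prop) (by fun_prop)))
  have hN : ∀ p ∈ U, 0 < N - p.1 := fun p hp => by rw [hU] at hp; exact hp.1
  let L : ℝ × ℝ → ℝ × ℝ →L[ℝ] ℝ := fun p =>
    Real.log (gfun C (lam p.1 p.2)) • ContinuousLinearMap.fst ℝ ℝ ℝ -
      Real.log (lam p.1 p.2) • ContinuousLinearMap.snd ℝ ℝ ℝ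
  have hsub : ∀ p ∈ U, ∀ q ∈ U, L p (q - p) ≤ F q.1 q.2 - F p.1 p.2 := by
    intro p hp q hq
    have h := mul_log_sub_log_le_log_gfun_sub C (hlampos _ _ hq) (hlampos _ _ hp)
    rw [hlam _ _ hq, div_mul_eq_mul_div, div_le_iff₀ (hN q hq)] at h
    simp only [L, hF, sub_apply, smul_apply, ContinuousLinearMap.coe_fst',
      ContinuousLinearMap.coe_snd', smul_eq_mul, Prod.fst_sub, Prod.snd_sub]
    linarith
  have hfd : ∀ p ∈ U, HasFDerivAt (fun p : ℝ × ℝ => F p.1 p.2) (L p) p := by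
    intro p hp
    have hnhds : ∀ᶠ q in nhds p, q ∈ U := hUo.mem_nhds hp
    have hlc : ContinuousAt (fun q : ℝ × ℝ => lam q.1 q.2) p := by
      refine (strictMonoOn_mul_deriv_gfun_div hC).continuousAt_of_comp_eventuallyEq
        (r := fun q : ℝ × ℝ => (n - q.2) / (N - q.1)) ?_ ?_
      · exact ContinuousAt.div (by fun_prop) (by fun_prop) (hN p hp).ne'
      · filter_upwards [hnhds] with q hq using ⟨hlampos _ _ hq, hlam _ _ hq⟩
    have hl0 := hlampos p.1 p.2 hp
    have hLc : ContinuousAt L p := by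
      have h1 := hlc.log hl0.ne'
      have h2 : ContinuousAt (fun q : ℝ × ℝ => Real.log (gfun C (lam q.1 q.2))) p :=
        ContinuousAt.log ((continuous_gfun C).continuousAt.comp hlc) (gfun_pos C hl0).ne'
      exact (h2.smul continuousAt_const).sub (h1.smul continuousAt_const)
    refine hasFDerivAt_of_subgradient_continuousAt hLc ?_
    filter_upwards [hnhds] with q hq
    refine ⟨hsub p hp q hq, ?_⟩
    have h := hsub q hq p hp
    rw [← neg_sub q p, map_neg] at h
    linarith
  refine ⟨fun p hp => (hfd p hp).differentiableAt.differentiableWithinAt, fun s t hst => ⟨?_, ?_⟩⟩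
  · have h := (hfd (s, t) hst).comp_hasDerivAt t ((hasDerivAt_const t s).prodMk (hasDerivAt_id t))
    simpa [L, Function.comp_def] using h
  · have h := (hfd (s, t) hst).comp_hasDerivAt s ((hasDerivAt_id s).prodMk (hasDerivAt_const s t))
    simpa [L, Function.comp_def] using h
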